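/- arXiv:2511.15491 — 2 statements merged into one kernel-verified Lean document; each statement's English description precedes it below -/
import Mathlib

section
/- Let G be a finite connected chordal graph, let s be a vertex of G, and let k ≥ 1. Let v and y be adjacent vertices with d(v,s) = d(y,s) = k, let u be a neighbor of v with d(u,s) = k−1, and let z be a neighbor of y with d(z,s) = k−1. Then u is adjacent to y, or z is adjacent to v. -/
open SimpleGraph

/-- A graph is chordal if it has no induced cycle of length at least 4. -/
def Chordal {V : Type} (G : SimpleGraph V) : Prop :=
  ∀ (s : Set V) (m : ℕ), 4 ≤ m → IsEmpty ((G.induce s) ≃g cycleGraph m)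

/-- An edge of a cycle graph joins consecutive indices or the first and the last one. -/
lemma cycleGraph_adj_iff_of_lt {m : ℕ} {a b : Fin m} (hab : a < b) :
    (cycleGraph m).Adj a b ↔ b.val = a.val + 1 ∨ (a.val = 0 ∧ b.val + 1 = m) := by
  rw [cycleGraph_adj', Fin.coe_sub_iff_lt.mpr hab, Fin.coe_sub_iff_le.mpr hab.le]
  have : a.val < b.val := hab
  omega

/-- A chordal graph contains no vertices `g 0, …, g (m - 1)` forming an induced cycle. -/
lemma Chordal.not_exists_cycle {V : Type} {G : SimpleGraph V} (hch : Chordal G) {m : ℕ}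
    (hm : 4 ≤ m) (g : ℕ → V) (hne : ∀ a b, a < b → b < m → g a ≠ g b)
    (hadj : ∀ a b, a < b → b < m →
      (G.Adj (g a) (g b) ↔ b = a + 1 ∨ (a = 0 ∧ b + 1 = m))) : False := by
  let f : cycleGraph m ↪g G :=
    { toFun := fun i => g i
      inj' := by
        intro a b h
        rcases lt_trichotomy a b with hab | hab | hab
        · exact (hne a b hab b.2 h).elim
        · exact hab
        · exact (hne b a hab a.2 h.symm).elim
      map_rel_iff' := by
        intro a b
        change G.Adj (g a) (g b) ↔ _
        rcases lt_trichotomy a b with hab | rfl | hab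
        · rw [hadj a b hab b.2, cycleGraph_adj_iff_of_lt hab]
        · simp
        · rw [G.adj_comm, (cycleGraph m).adj_comm, hadj b a hab a.2,
            cycleGraph_adj_iff_of_lt hab] }
  exact (hch _ m hm).false f.isoInduceRange.symm

/-- The `i`-th vertex of a shortest walk is at distance `i` from the start. -/
lemma dist_getVert_of_length_eq_dist {W : Type*} {H : SimpleGraph W} {a b : W} (p : H.Walk a b)
    (hp : p.length = H.dist a b) {i : ℕ} (hi : i ≤ p.length) : H.dist a (p.getVert i) = i := by
  have h1 := dist_le (p.take i)
  have h2 := dist_le (p.drop i)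
  have h3 := (p.take i).reachable.dist_triangle_left b
  simp only [Walk.take_length, Walk.drop_length] at h1 h2
  omega

/-- The distance to `s` changes by at most one along an edge. -/
lemma dist_le_succ_of_adj {V : Type*} {G : SimpleGraph V} (hconn : G.Connected) {a b : V}
    (h : G.Adj a b) (s : V) : G.dist a s ≤ G.dist b s + 1 := by
  have := hconn.dist_triangle (u := a) (v := b) (w := s)
  rw [dist_eq_one_iff_adj.mpr h] at this
  omega

/-- If `A` contains, with each vertex other than `s`, all its neighbors closer to `s`, then each
vertex of `A` is joined to `s` inside `A`. -/
lemma reachable_induce_of_closer_mem {V : Type*} {G : SimpleGraph V} (hconn : G.Connected)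
    {A : Set V} {s : V} (hs : s ∈ A)
    (hA : ∀ w ∈ A, ∀ w', G.Adj w w' → G.dist w s = G.dist w' s + 1 → w' ∈ A)
    (w : V) (hw : w ∈ A) : (G.induce A).Reachable ⟨w, hw⟩ ⟨s, hs⟩ := by
  induction hn : G.dist w s generalizing w with
  | zero =>
    obtain rfl := hconn.dist_eq_zero_iff.mp hn
    rfl
  | succ n ih =>
    obtain ⟨p, hp⟩ := hconn.exists_walk_length_eq_dist w s
    cases p with
    | nil => simp at hn
    | @cons _ w' _ h q =>
      have h1 := dist_le q
      have h2 := dist_le_succ_of_adj hconn h s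
      rw [Walk.length_cons] at hp
      have hw' : w' ∈ A := hA w hw w' h (by omega)
      have hww' : (G.induce A).Adj ⟨w, hw⟩ ⟨w', hw'⟩ := h
      exact hww'.reachable.trans (ih w' hw' (by omega))

/-- In a finite connected chordal graph, let `v` and `y` be adjacent vertices at
distance `k ≥ 1` from `s`, let `u` be a neighbor of `v` at distance `k−1` from
`s`, and let `z` be a neighbor of `y` at distance `k−1` from `s`. Then `u` is
adjacent to `y`, or `z` is adjacent to `v`. -/
theorem chordal_cross_adjacency
    {V : Type} [Fintype V] {G : SimpleGraph V}
    (hconn : G.Connected) (hch : Chordal G)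
    (s v y u z : V) (k : ℕ) (hk : 1 ≤ k)
    (hvy : G.Adj v y) (hv : G.dist v s = k) (hy : G.dist y s = k)
    (hvu : G.Adj v u) (hu : G.dist u s + 1 = k)
    (hyz : G.Adj y z) (hz : G.dist z s + 1 = k) :
    G.Adj u y ∨ G.Adj z v := by
  by_contra hcon
  push Not at hcon
  obtain ⟨huy, hzv⟩ := hcon
  have huz : u ≠ z := fun h => huy (h ▸ hyz.symm)
  have hk2 : 2 ≤ k := by
    by_contra hlt
    have hu0 := hconn.dist_eq_zero_iff.mp (show G.dist u s = 0 by omega)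
    have hz0 := hconn.dist_eq_zero_iff.mp (show G.dist z s = 0 by omega)
    exact huz (hu0.trans hz0.symm)
  let A : Set V := {w | G.dist w s + 2 ≤ k ∨ w = u ∨ w = z}
  have hsA : s ∈ A := Or.inl (by simpa using hk2)
  have huA : u ∈ A := Or.inr (Or.inl rfl)
  have hzA : z ∈ A := Or.inr (Or.inr rfl)
  have hAk : ∀ w ∈ A, G.dist w s + 1 ≤ k := by
    rintro w (h | rfl | rfl) <;> omega
  have hreach := reachable_induce_of_closer_mem hconn hsA (fun w hw w' _ hd =>
    Or.inl (by have := hAk w hw; omega))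
  obtain ⟨p, hp⟩ := ((hreach u huA).trans (hreach z hzA).symm).exists_walk_length_eq_dist
  have hpd := fun i hi => dist_getVert_of_length_eq_dist p hp (i := i) hi
  set d := p.length with hd
  let P : ℕ → V := fun i => p.getVert i
  have hP0 : P 0 = u := by simp [P]
  have hPd : P d = z := by simp [P, hd]
  have hPA : ∀ i, P i ∈ A := fun i => (p.getVert i).2
  have hd1 : 1 ≤ d := by
    rcases Nat.eq_zero_or_pos d with h | h
    · rw [h, hP0] at hPd
      exact (huz hPd).elim
    · exact h
  have hPne : ∀ a b, a < b → b ≤ d → P a ≠ P b := by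
    intro a b hab hb h
    have h' := hpd a (by omega)
    rw [Subtype.ext h, hpd b hb] at h'
    omega
  have hPadj : ∀ a b, a < b → b ≤ d → (G.Adj (P a) (P b) ↔ b = a + 1) := by
    intro a b hab hb
    constructor
    · intro h
      have hH : ((G.induce A)).Adj (p.getVert a) (p.getVert b) := h
      have h3 := hH.reachable.dist_triangle_right ⟨u, huA⟩
      rw [dist_eq_one_iff_adj.mpr hH, hpd a (by omega), hpd b hb] at h3
      omega
    · rintro rfl
      exact p.adj_getVert_succ (by omega)
  have hPlow : ∀ i ≤ d, ∀ x, G.dist x s = k → G.Adj (P i) x → i = 0 ∨ i = d := by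
    intro i hi x hx hadj
    have h1 := dist_le_succ_of_adj hconn hadj.symm s
    rcases hPA i with h | h | h
    · omega
    · rcases Nat.eq_zero_or_pos i with h0 | h0
      · exact Or.inl h0
      · exact (hPne 0 i h0 hi (hP0.trans h.symm)).elim
    · rcases hi.eq_or_lt with h0 | h0
      · exact Or.inr h0
      · exact (hPne i d h0 le_rfl (h.trans hPd.symm)).elim
  have hPy : ∀ i ≤ d, (G.Adj (P i) y ↔ i = d) := by
    refine fun i hi => ⟨fun h => ?_, ?_⟩
    · rcases hPlow i hi y hy h with rfl | h0
      · exact (huy (hP0 ▸ h)).elim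
      · exact h0
    · rintro rfl
      exact hPd ▸ hyz.symm
  have hPv : ∀ i ≤ d, (G.Adj (P i) v ↔ i = 0) := by
    refine fun i hi => ⟨fun h => ?_, ?_⟩
    · rcases hPlow i hi v hv h with h0 | rfl
      · exact h0
      · exact (hzv (hPd ▸ h)).elim
    · rintro rfl
      exact hP0 ▸ hvu.symm
  have hPne' : ∀ i, ∀ x, G.dist x s = k → P i ≠ x := by
    rintro i x hx rfl
    have := hAk _ (hPA i)
    omega
  let g : ℕ → V := fun i => if i ≤ d then P i else if i = d + 1 then y else v
  have hgP : ∀ i ≤ d, g i = P i := fun i hi => if_pos hi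
  have hgy : g (d + 1) = y := by simp [g]
  have hgv : g (d + 2) = v := by simp [g]
  refine hch.not_exists_cycle (m := d + 3) (by omega) g ?_ ?_
  · intro a b hab hb
    obtain hb | rfl | rfl : b ≤ d ∨ b = d + 1 ∨ b = d + 2 := by omega
    · rw [hgP a (by omega), hgP b hb]
      exact hPne a b hab hb
    · rw [hgP a (by omega), hgy]
      exact hPne' a y hy
    · rw [hgv]
      obtain ha | rfl : a ≤ d ∨ a = d + 1 := by omega
      · rw [hgP a ha]
        exact hPne' a v hv
      · rw [hgy]
        exact hvy.ne'
  · intro a b hab hb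
    obtain hb | rfl | rfl : b ≤ d ∨ b = d + 1 ∨ b = d + 2 := by omega
    · rw [hgP a (by omega), hgP b hb, hPadj a b hab hb]
      omega
    · rw [hgP a (by omega), hgy, hPy a (by omega)]
      omega
    · rw [hgv]
      obtain ha | rfl : a ≤ d ∨ a = d + 1 := by omega
      · rw [hgP a ha, hPv a ha]
        omega
      · rw [hgy]
        exact iff_of_true hvy.symm (Or.inl rfl)
end

section
/- Let k, q ≥ 2 and let G be the k×q grid graph. Let P : V(G) → ℕ satisfy: (a) every vertex v with P(v) = 0 has P(u) = 1 for every neighbor u of v; (b) for all adjacent vertices u, v, |P(u) − P(v)| = 1; (c) every vertex v with P(v) > 0 has some neighbor u with P(u) = P(v) − 1; (d) no vertex v has more than two neighbors u with P(u) = P(v) − 1; (e) no vertex has two distinct vertices in its closed neighborhood (itself together with its neighbors) with value 0 under P. Then there is exactly one vertex s with P(s) = 0, and P(v) = d(v,s) for every vertex v. -/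
open SimpleGraph

/-- The `k × q` grid graph: the box (Cartesian) product of a path on `k`
vertices and a path on `q` vertices. -/
def gridGraph (k q : ℕ) : SimpleGraph (Fin k × Fin q) :=
  pathGraph k □ pathGraph q

section Walks

variable {V : Type*} {G : SimpleGraph V} {P : V → ℕ}

/-- A function changing by at most one along edges changes by at most the length of a walk. -/
lemma le_add_walk_length (hP : ∀ u v, G.Adj u v → P u ≤ P v + 1) {u v : V} (p : G.Walk u v) :
    P u ≤ P v + p.length := by
  induction p with
  | nil => simp
  | cons h p ih =>
    have := hP _ _ h
    rw [Walk.length_cons]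
    omega

/-- A function changing by exactly one along edges has the parity of walk lengths. -/
lemma even_add_walk_length (hP : ∀ u v, G.Adj u v → P u = P v + 1 ∨ P v = P u + 1)
    {u v : V} (p : G.Walk u v) : Even (P u + P v + p.length) := by
  induction p with
  | nil => simp
  | cons h p ih =>
    have := hP _ _ h
    rw [Walk.length_cons]
    rw [Nat.even_iff] at ih ⊢
    omega

/-- Following decreasing neighbors reaches a zero of `P` after `P v` steps. -/
lemma exists_zero_dist_le (hP : ∀ v, 0 < P v → ∃ u, G.Adj v u ∧ P u + 1 = P v) (v : V) :
    ∃ r, P r = 0 ∧ G.dist v r ≤ P v := by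
  suffices h : ∀ n v, P v = n → ∃ r, P r = 0 ∧ ∃ p : G.Walk v r, p.length = n by
    obtain ⟨r, hr, p, hp⟩ := h _ v rfl
    exact ⟨r, hr, hp ▸ dist_le p⟩
  intro n
  induction n with
  | zero => exact fun v hv => ⟨v, hv, Walk.nil, rfl⟩
  | succ n ih =>
    intro v hv
    obtain ⟨u, hvu, hu⟩ := hP v (by omega)
    obtain ⟨r, hr, p, hp⟩ := ih u (by omega)
    exact ⟨r, hr, Walk.cons hvu p, by simp [hp]⟩

end Walks

section Grid

variable {k q : ℕ}

/-- The taxicab distance between two vertices of the grid. -/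
def taxicab (u v : Fin k × Fin q) : ℕ :=
  ((u.1 : ℕ) - v.1 + (v.1 - u.1)) + ((u.2 : ℕ) - v.2 + (v.2 - u.2))

lemma gridGraph_adj_iff {u v : Fin k × Fin q} : (gridGraph k q).Adj u v ↔ taxicab u v = 1 := by
  rw [gridGraph, boxProd_adj, pathGraph_adj, pathGraph_adj, Fin.ext_iff, Fin.ext_iff, taxicab]
  omega

lemma taxicab_le (v a b : Fin k × Fin q) : taxicab a b ≤ taxicab v a + taxicab v b := by
  simp only [taxicab]
  omega

lemma exists_walk_length_eq_taxicab (u v : Fin k × Fin q) :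
    ∃ p : (gridGraph k q).Walk u v, p.length = taxicab u v := by
  suffices h : ∀ n (u : Fin k × Fin q), taxicab u v = n →
      ∃ p : (gridGraph k q).Walk u v, p.length = n from h _ u rfl
  obtain ⟨⟨x', hx'⟩, ⟨y', hy'⟩⟩ := v
  intro n
  induction n with
  | zero =>
    rintro ⟨⟨x, hx⟩, ⟨y, hy⟩⟩ h
    simp only [taxicab] at h
    obtain rfl : x = x' := by omega
    obtain rfl : y = y' := by omega
    exact ⟨Walk.nil, rfl⟩
  | succ n ih =>
    rintro ⟨⟨x, hx⟩, ⟨y, hy⟩⟩ h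
    obtain ⟨w, hw, hwn⟩ : ∃ w : Fin k × Fin q, taxicab (⟨x, hx⟩, ⟨y, hy⟩) w = 1 ∧
        taxicab w (⟨x', hx'⟩, ⟨y', hy'⟩) = n := by
      simp only [taxicab] at h
      rcases lt_trichotomy x x' with hlt | heq | hgt
      · exact ⟨(⟨x + 1, by omega⟩, ⟨y, hy⟩), by simp only [taxicab]; omega,
          by simp only [taxicab]; omega⟩
      · rcases lt_or_ge y y' with hlt | hge
        · exact ⟨(⟨x, hx⟩, ⟨y + 1, by omega⟩), by simp only [taxicab]; omega,
            by simp only [taxicab]; omega⟩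
        · exact ⟨(⟨x, hx⟩, ⟨y - 1, by omega⟩), by simp only [taxicab]; omega,
            by simp only [taxicab]; omega⟩
      · exact ⟨(⟨x - 1, by omega⟩, ⟨y, hy⟩), by simp only [taxicab]; omega,
          by simp only [taxicab]; omega⟩
    obtain ⟨p, hp⟩ := ih w hwn
    exact ⟨Walk.cons (gridGraph_adj_iff.2 hw) p, by simp [hp]⟩

lemma gridGraph_dist (u v : Fin k × Fin q) : (gridGraph k q).dist u v = taxicab u v := by
  obtain ⟨p, hp⟩ := exists_walk_length_eq_taxicab u v
  obtain ⟨p', hp'⟩ := p.reachable.exists_walk_length_eq_dist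
  have hle : taxicab u v ≤ taxicab v v + p'.length :=
    le_add_walk_length (P := fun w => taxicab w v)
      (fun a b h => by rw [gridGraph_adj_iff] at h; simp only [taxicab] at h ⊢; omega) p'
  have h0 : taxicab v v = 0 := by simp [taxicab]
  have := dist_le p
  omega

variable {P : Fin k × Fin q → ℕ}

/-- Under the local rules (b)–(e), two distinct zeros cannot be at minimal distance. -/
lemma not_closest_zeros (hk : 2 ≤ k) (hq : 2 ≤ q)
    (hb : ∀ u v, (gridGraph k q).Adj u v → (P u = P v + 1 ∨ P v = P u + 1))
    (hc : ∀ v, 0 < P v → ∃ u, (gridGraph k q).Adj v u ∧ P u + 1 = P v)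
    (hd : ∀ v, ({u | (gridGraph k q).Adj v u ∧ P u + 1 = P v}).ncard ≤ 2)
    (he : ∀ v x y, (x = v ∨ (gridGraph k q).Adj v x) → (y = v ∨ (gridGraph k q).Adj v y) →
      P x = 0 → P y = 0 → x = y)
    {s t : Fin k × Fin q} (hs : P s = 0) (ht : P t = 0) (hst : s ≠ t)
    (hmin : ∀ s' t', P s' = 0 → P t' = 0 → s' ≠ t' → taxicab s t ≤ taxicab s' t')
    (hle : s.1 ≤ t.1) : False := by
  have lip (u v) : P u ≤ P v + taxicab u v := by
    obtain ⟨p, hp⟩ := exists_walk_length_eq_taxicab u v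
    exact hp ▸ le_add_walk_length (fun a b h => by have := hb a b h; omega) p
  obtain ⟨m, hm⟩ : Even (taxicab s t) := by
    obtain ⟨p, hp⟩ := exists_walk_length_eq_taxicab s t
    simpa [hs, ht, hp] using even_add_walk_length hb p
  have mid (v) (hvs : taxicab v s = m) (hvt : taxicab v t = m) : P v = m := by
    have h1 := lip v s
    by_contra hne
    obtain ⟨r, hr, hvr⟩ := exists_zero_dist_le hc v
    rw [gridGraph_dist] at hvr
    have hrs : r = s := by
      by_contra hrs
      have := hmin r s hr hs hrs
      have := taxicab_le v r s
      omega
    have hrt : r = t := by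
      by_contra hrt
      have := hmin r t hr ht hrt
      have := taxicab_le v r t
      omega
    exact hst (hrs.symm.trans hrt)
  have three (v a b c : Fin k × Fin q) (hab : a ≠ b) (hac : a ≠ c) (hbc : b ≠ c)
      (hva : taxicab v a = 1) (hvb : taxicab v b = 1) (hvc : taxicab v c = 1)
      (ha : P a < P v) (hb' : P b < P v) (hc' : P c < P v) : False := by
    have hmem (w) (hw : taxicab v w = 1) (hlt : P w < P v) :
        w ∈ {u | (gridGraph k q).Adj v u ∧ P u + 1 = P v} := by
      have hadj := gridGraph_adj_iff.2 hw
      have := hb _ _ hadj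
      exact ⟨hadj, by omega⟩
    have := (Set.two_lt_ncard_iff (Set.toFinite _)).2
      ⟨a, b, c, hmem a hva ha, hmem b hvb hb', hmem c hvc hc', hab, hac, hbc⟩
    have := hd v
    omega
  -- A vertex halfway between `s` and `t` cannot have three neighbors closer to `s` or `t`.
  have halfway (v a b c : Fin k × Fin q) (hvs : taxicab v s = m) (hvt : taxicab v t = m)
      (hab : a ≠ b) (hac : a ≠ c) (hbc : b ≠ c)
      (hva : taxicab v a = 1) (hvb : taxicab v b = 1) (hvc : taxicab v c = 1)
      (ha : taxicab a s < m ∨ taxicab a t < m) (hb' : taxicab b s < m ∨ taxicab b t < m)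
      (hc' : taxicab c s < m ∨ taxicab c t < m) : False := by
    have hlt (w) (hw : taxicab w s < m ∨ taxicab w t < m) : P w < P v := by
      have := lip w s
      have := lip w t
      have := mid v hvs hvt
      omega
    exact three v a b c hab hac hbc hva hvb hvc (hlt a ha) (hlt b hb') (hlt c hc')
  -- If `s` and `t` lie on a line, compare their midpoint with its neighbor on a parallel line.
  have straight (v a b w a' b' : Fin k × Fin q) (hvs : taxicab v s = m) (hvt : taxicab v t = m)
      (hab : a ≠ b) (haw : a ≠ w) (hbw : b ≠ w) (hab' : a' ≠ b') (hav' : a' ≠ v) (hbv' : b' ≠ v)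
      (hva : taxicab v a = 1) (hvb : taxicab v b = 1) (hvw : taxicab v w = 1)
      (hwv : taxicab w v = 1) (hwa : taxicab w a' = 1) (hwb : taxicab w b' = 1)
      (ha : taxicab a s < m) (hb' : taxicab b t < m)
      (ha' : taxicab a' s ≤ m) (hbt' : taxicab b' t ≤ m) : False := by
    have hv := mid v hvs hvt
    have := lip a s
    have := lip b t
    have := lip a' s
    have := lip b' t
    rcases hb v w (gridGraph_adj_iff.2 hvw) with h | h
    · exact three v a b w hab haw hbw hva hvb hvw (by omega) (by omega) (by omega)
    · exact three w a' b' v hab' hav' hbv' hwa hwb hwv (by omega) (by omega) (by omega)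
  clear lip mid three hmin hb hc hd
  have hm0 : 0 < m := by
    by_contra h0
    refine hst (Prod.ext (Fin.ext ?_) (Fin.ext ?_)) <;> simp only [taxicab] at hm <;> omega
  obtain ⟨⟨x₀, hx₀⟩, ⟨y₀, hy₀⟩⟩ := s
  obtain ⟨⟨x₁, hx₁⟩, ⟨y₁, hy₁⟩⟩ := t
  simp only [Fin.mk_le_mk] at hle
  simp only [taxicab, ne_eq, Prod.ext_iff, Fin.ext_iff] at *
  rcases eq_or_lt_of_le hle with rfl | hx
  · obtain ⟨x', hx', hxx⟩ : ∃ x' < k, x' = x₀ + 1 ∨ x₀ = x' + 1 := by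
      rcases Nat.eq_zero_or_pos x₀ with h | h
      · exact ⟨x₀ + 1, by omega, by omega⟩
      · exact ⟨x₀ - 1, by omega, by omega⟩
    rcases le_total y₀ y₁ with hy | hy
    · refine straight
        (⟨x₀, by omega⟩, ⟨y₀ + m, by omega⟩)
        (⟨x₀, by omega⟩, ⟨y₀ + (m - 1), by omega⟩)
        (⟨x₀, by omega⟩, ⟨y₀ + (m + 1), by omega⟩)
        (⟨x', by omega⟩, ⟨y₀ + m, by omega⟩)
        (⟨x', by omega⟩, ⟨y₀ + (m - 1), by omega⟩)
        (⟨x', by omega⟩, ⟨y₀ + (m + 1), by omega⟩)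
        ?_ ?_ ?_ ?_ ?_ ?_ ?_ ?_ ?_ ?_ ?_ ?_ ?_ ?_ ?_ ?_ ?_ ?_ <;>
        dsimp only <;> omega
    · refine straight
        (⟨x₀, by omega⟩, ⟨y₀ - m, by omega⟩)
        (⟨x₀, by omega⟩, ⟨y₀ - (m - 1), by omega⟩)
        (⟨x₀, by omega⟩, ⟨y₀ - (m + 1), by omega⟩)
        (⟨x', by omega⟩, ⟨y₀ - m, by omega⟩)
        (⟨x', by omega⟩, ⟨y₀ - (m - 1), by omega⟩)
        (⟨x', by omega⟩, ⟨y₀ - (m + 1), by omega⟩)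
        ?_ ?_ ?_ ?_ ?_ ?_ ?_ ?_ ?_ ?_ ?_ ?_ ?_ ?_ ?_ ?_ ?_ ?_ <;>
        dsimp only <;> omega
  rcases eq_or_ne y₀ y₁ with rfl | hy
  · obtain ⟨y', hy', hyy⟩ : ∃ y' < q, y' = y₀ + 1 ∨ y₀ = y' + 1 := by
      rcases Nat.eq_zero_or_pos y₀ with h | h
      · exact ⟨y₀ + 1, by omega, by omega⟩
      · exact ⟨y₀ - 1, by omega, by omega⟩
    refine straight
      (⟨x₀ + m, by omega⟩, ⟨y₀, by omega⟩)
      (⟨x₀ + (m - 1), by omega⟩, ⟨y₀, by omega⟩)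
      (⟨x₀ + (m + 1), by omega⟩, ⟨y₀, by omega⟩)
      (⟨x₀ + m, by omega⟩, ⟨y', by omega⟩)
      (⟨x₀ + (m - 1), by omega⟩, ⟨y', by omega⟩)
      (⟨x₀ + (m + 1), by omega⟩, ⟨y', by omega⟩)
      ?_ ?_ ?_ ?_ ?_ ?_ ?_ ?_ ?_ ?_ ?_ ?_ ?_ ?_ ?_ ?_ ?_ ?_ <;>
      dsimp only <;> omega
  rcases eq_or_ne m 1 with rfl | hm1
  · have := he (⟨x₁, hx₁⟩, ⟨y₀, hy₀⟩) (⟨x₀, hx₀⟩, ⟨y₀, hy₀⟩) (⟨x₁, hx₁⟩, ⟨y₁, hy₁⟩)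
      (.inr (gridGraph_adj_iff.2 (by simp only [taxicab]; omega)))
      (.inr (gridGraph_adj_iff.2 (by simp only [taxicab]; omega))) hs ht
    dsimp only at this
    omega
  rcases lt_or_gt_of_ne hy with hy | hy
  · rcases lt_trichotomy (x₁ - x₀) m with h | h | h
    · refine halfway
        (⟨x₀, by omega⟩, ⟨y₀ + m, by omega⟩)
        (⟨x₀, by omega⟩, ⟨y₀ + (m - 1), by omega⟩)
        (⟨x₀, by omega⟩, ⟨y₀ + (m + 1), by omega⟩)
        (⟨x₀ + 1, by omega⟩, ⟨y₀ + m, by omega⟩)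
        ?_ ?_ ?_ ?_ ?_ ?_ ?_ ?_ ?_ ?_ ?_ <;>
        dsimp only <;> omega
    · refine halfway
        (⟨x₀ + 1, by omega⟩, ⟨y₀ + (m - 1), by omega⟩)
        (⟨x₀, by omega⟩, ⟨y₀ + (m - 1), by omega⟩)
        (⟨x₀ + 2, by omega⟩, ⟨y₀ + (m - 1), by omega⟩)
        (⟨x₀ + 1, by omega⟩, ⟨y₀ + m, by omega⟩)
        ?_ ?_ ?_ ?_ ?_ ?_ ?_ ?_ ?_ ?_ ?_ <;>
        dsimp only <;> omega
    · refine halfway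
        (⟨x₀ + m, by omega⟩, ⟨y₀, by omega⟩)
        (⟨x₀ + (m - 1), by omega⟩, ⟨y₀, by omega⟩)
        (⟨x₀ + (m + 1), by omega⟩, ⟨y₀, by omega⟩)
        (⟨x₀ + m, by omega⟩, ⟨y₀ + 1, by omega⟩)
        ?_ ?_ ?_ ?_ ?_ ?_ ?_ ?_ ?_ ?_ ?_ <;>
        dsimp only <;> omega
  · rcases lt_trichotomy (x₁ - x₀) m with h | h | h
    · refine halfway
        (⟨x₀, by omega⟩, ⟨y₀ - m, by omega⟩)
        (⟨x₀, by omega⟩, ⟨y₀ - (m - 1), by omega⟩)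
        (⟨x₀, by omega⟩, ⟨y₀ - (m + 1), by omega⟩)
        (⟨x₀ + 1, by omega⟩, ⟨y₀ - m, by omega⟩)
        ?_ ?_ ?_ ?_ ?_ ?_ ?_ ?_ ?_ ?_ ?_ <;>
        dsimp only <;> omega
    · refine halfway
        (⟨x₀ + 1, by omega⟩, ⟨y₀ - (m - 1), by omega⟩)
        (⟨x₀, by omega⟩, ⟨y₀ - (m - 1), by omega⟩)
        (⟨x₀ + 2, by omega⟩, ⟨y₀ - (m - 1), by omega⟩)
        (⟨x₀ + 1, by omega⟩, ⟨y₀ - m, by omega⟩)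
        ?_ ?_ ?_ ?_ ?_ ?_ ?_ ?_ ?_ ?_ ?_ <;>
        dsimp only <;> omega
    · refine halfway
        (⟨x₀ + m, by omega⟩, ⟨y₀, by omega⟩)
        (⟨x₀ + (m - 1), by omega⟩, ⟨y₀, by omega⟩)
        (⟨x₀ + (m + 1), by omega⟩, ⟨y₀, by omega⟩)
        (⟨x₀ + m, by omega⟩, ⟨y₀ - 1, by omega⟩)
        ?_ ?_ ?_ ?_ ?_ ?_ ?_ ?_ ?_ ?_ ?_ <;>
        dsimp only <;> omega

end Grid

/-- Soundness of the distance certificates in grid graphs: in the `k × q` grid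
graph (`k, q ≥ 2`), if `P` satisfies the local rules (a)–(e), then there is
exactly one vertex `s` with `P s = 0`, and `P v = d(v, s)` for every vertex. -/
theorem grid_local_rules_imply_distance
    (k q : ℕ) (hk : 2 ≤ k) (hq : 2 ≤ q)
    (P : Fin k × Fin q → ℕ)
    -- (a) every vertex with value 0 has all its neighbors of value 1
    (ha : ∀ v, P v = 0 → ∀ u, (gridGraph k q).Adj v u → P u = 1)
    -- (b) values of adjacent vertices differ by exactly 1
    (hb : ∀ u v, (gridGraph k q).Adj u v → (P u = P v + 1 ∨ P v = P u + 1))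
    -- (c) every vertex with positive value has a neighbor of value one less
    (hc : ∀ v, 0 < P v → ∃ u, (gridGraph k q).Adj v u ∧ P u + 1 = P v)
    -- (d) no vertex has more than two neighbors of value one less than its own
    (hd : ∀ v, ({u | (gridGraph k q).Adj v u ∧ P u + 1 = P v}).ncard ≤ 2)
    -- (e) no vertex has two distinct vertices of value 0 in its closed neighborhood
    (he : ∀ v x y, (x = v ∨ (gridGraph k q).Adj v x) → (y = v ∨ (gridGraph k q).Adj v y) →
      P x = 0 → P y = 0 → x = y) :
    ∃ s, P s = 0 ∧ (∀ t, P t = 0 → t = s) ∧ ∀ v, P v = (gridGraph k q).dist v s := by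
  have huniq (s t) (hs : P s = 0) (ht : P t = 0) : s = t := by
    by_contra hst
    obtain ⟨⟨s, t⟩, ⟨hs, ht, hst⟩, hmin⟩ := Set.exists_min_image
      {p : (Fin k × Fin q) × (Fin k × Fin q) | P p.1 = 0 ∧ P p.2 = 0 ∧ p.1 ≠ p.2}
      (fun p => taxicab p.1 p.2) (Set.toFinite _) ⟨(s, t), hs, ht, hst⟩
    have hmin' (s' t') (hs' : P s' = 0) (ht' : P t' = 0) (hne : s' ≠ t') :
        taxicab s t ≤ taxicab s' t' := hmin (s', t') ⟨hs', ht', hne⟩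
    rcases le_total s.1 t.1 with h | h
    · exact not_closest_zeros hk hq hb hc hd he hs ht hst hmin' h
    · have hcomm : taxicab t s = taxicab s t := by simp only [taxicab]; omega
      exact not_closest_zeros hk hq hb hc hd he ht hs (Ne.symm hst) (hcomm ▸ hmin') h
  obtain ⟨s, hs, -⟩ := exists_zero_dist_le hc (⟨0, by omega⟩, ⟨0, by omega⟩)
  refine ⟨s, hs, fun t ht => huniq t s ht hs, fun v => le_antisymm ?_ ?_⟩
  · obtain ⟨p, hp⟩ := exists_walk_length_eq_taxicab v s
    have := le_add_walk_length (P := P) (fun a b h => by have := hb a b h; omega) p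
    rw [gridGraph_dist]
    omega
  · obtain ⟨r, hr, hvr⟩ := exists_zero_dist_le hc v
    rwa [huniq r s hr hs] at hvr
end
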